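/- arXiv:2010.00448 — 2 statements merged into one kernel-verified Lean document; each statement's English description precedes it below -/
import Mathlib

section
/- Let σ > 0, let f belong sectionally to (ℰ_σ^∞)_+(ℝ²) with M = sup_{(x,y)∈ℝ²}|f(x,y)|, and put κ(x) = (1 − ix)^{-1}. Then there exist sequences (φ_n)_{n∈ℕ} and (ψ_n)_{n∈ℕ} of functions on ℝ, each of which is the restriction to ℝ of a function continuous on the closed upper half-plane {Im z ≥ 0} and bounded and analytic in the open upper half-plane, such that κ(x) f(x,y) = ∑_{n∈ℕ} φ_n(x) ψ_n(y) for all x, y ∈ ℝ (with absolute convergence), and (sup_{x∈ℝ} ∑_{n∈ℕ} |φ_n(x)|²)^{1/2} · (sup_{y∈ℝ} ∑_{n∈ℕ} |ψ_n(y)|²)^{1/2} ≤ ((2/√π)σ + 1) M. -/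
open MeasureTheory

/-- The class `(ℰ_σ^∞)₊`: entire functions that are bounded on the closed upper half-plane
and such that `e^{-iσz} f(z)` is bounded on the closed lower half-plane (equivalently,
bounded functions on `ℝ` whose Fourier transform is supported in `[0, σ]`). -/
def MemEInftyPlus (σ : ℝ) (f : ℂ → ℂ) : Prop :=
  Differentiable ℂ f ∧
  (∃ C : ℝ, ∀ z : ℂ, 0 ≤ z.im → ‖f z‖ ≤ C) ∧
  (∃ C : ℝ, ∀ z : ℂ, z.im ≤ 0 → ‖Complex.exp (-(Complex.I * (σ : ℂ) * z)) * f z‖ ≤ C)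

/-- The factor `(e^{iσy} − 1)/(i(σy − 2πn))`, understood as the value `1` of its entire
extension when `σy = 2πn`. -/
noncomputable def sincFac (σ : ℝ) (n : ℤ) (y : ℝ) : ℂ :=
  if σ * y = 2 * Real.pi * n then 1
  else (Complex.exp (Complex.I * ((σ * y : ℝ) : ℂ)) - 1) /
    (Complex.I * (((σ * y : ℝ) : ℂ) - ((2 * Real.pi * n : ℝ) : ℂ)))

/-- `f : ℂ × ℂ → ℂ` belongs sectionally to `(ℰ_σ^∞)₊(ℝ²)`: for every `a ∈ ℝ` the
functions `z ↦ f(z, a)` and `z ↦ f(a, z)` belong to `(ℰ_σ^∞)₊`. -/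
def SectEInftyPlus (σ : ℝ) (f : ℂ → ℂ → ℂ) : Prop :=
  ∀ a : ℝ, MemEInftyPlus σ (fun z => f z (a : ℂ)) ∧ MemEInftyPlus σ (fun z => f (a : ℂ) z)

open Complex Filter Topology

/-- The exponential weight controlling functions with spectrum in `[0, 2π]`. -/
noncomputable def expWeight (z : ℂ) : ℝ := 1 + Real.exp (-(2 * Real.pi * z.im))

/-- The function `z ↦ e^{2πiz} - 1`, whose zeros are the integers. -/
noncomputable def expSubOne (z : ℂ) : ℂ := exp (2 * Real.pi * I * z) - 1

/-- The entire extension of `z ↦ (e^{2πiz} - 1) / (2πiz)`. -/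
noncomputable def expSinc (z : ℂ) : ℂ := dslope expSubOne 0 z / (2 * Real.pi * I)

lemma one_le_expWeight (z : ℂ) : 1 ≤ expWeight z := by
  unfold expWeight; linarith [Real.exp_pos (-(2 * Real.pi * z.im))]

lemma expWeight_le_two {z : ℂ} (hz : 0 ≤ z.im) : expWeight z ≤ 2 := by
  have : Real.exp (-(2 * Real.pi * z.im)) ≤ 1 :=
    Real.exp_le_one_iff.2 (by have := Real.pi_pos; simp only [Left.neg_nonpos_iff]; positivity)
  unfold expWeight; linarith

lemma expWeight_sub_intCast (z : ℂ) (n : ℤ) : expWeight (z - n) = expWeight z := by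
  simp [expWeight]

lemma norm_exp_two_pi_I_mul (z : ℂ) :
    ‖exp (2 * Real.pi * I * z)‖ = Real.exp (-(2 * Real.pi * z.im)) := by
  simp [Complex.norm_exp]

lemma norm_expSubOne_le (z : ℂ) : ‖expSubOne z‖ ≤ expWeight z := by
  refine (norm_sub_le _ _).trans ?_
  rw [norm_exp_two_pi_I_mul, norm_one, add_comm, expWeight]

lemma hasDerivAt_expSubOne (z : ℂ) :
    HasDerivAt expSubOne (exp (2 * Real.pi * I * z) * (2 * Real.pi * I)) z := by
  have h := (((hasDerivAt_id z).const_mul (2 * Real.pi * I)).cexp).sub_const 1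
  rwa [mul_one] at h

lemma differentiable_expSubOne : Differentiable ℂ expSubOne :=
  fun z => (hasDerivAt_expSubOne z).differentiableAt

lemma deriv_expSubOne_ne_zero (z : ℂ) : deriv expSubOne z ≠ 0 := by
  rw [(hasDerivAt_expSubOne z).deriv]
  exact mul_ne_zero (exp_ne_zero _) two_pi_I_ne_zero

lemma expSubOne_eq_zero_iff {z : ℂ} : expSubOne z = 0 ↔ ∃ n : ℤ, z = n := by
  rw [expSubOne, sub_eq_zero, Complex.exp_eq_one_iff]
  refine exists_congr fun n => ?_
  rw [mul_comm (2 * Real.pi * I : ℂ) z]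
  exact mul_left_inj' two_pi_I_ne_zero

lemma Differentiable.dslope {f : ℂ → ℂ} (hf : Differentiable ℂ f) (c : ℂ) :
    Differentiable ℂ (dslope f c) :=
  differentiableOn_univ.1 ((Complex.differentiableOn_dslope univ_mem).2 hf.differentiableOn)

lemma differentiable_expSinc : Differentiable ℂ expSinc :=
  (differentiable_expSubOne.dslope 0).div_const _

lemma mul_expSinc (z : ℂ) : 2 * Real.pi * I * z * expSinc z = expSubOne z := by
  have h := sub_smul_dslope expSubOne 0 z
  have h0 : expSubOne 0 = 0 := expSubOne_eq_zero_iff.2 ⟨0, by simp⟩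
  rw [h0, sub_zero, sub_zero, smul_eq_mul] at h
  rw [← h, expSinc]
  field_simp [two_pi_I_ne_zero]

lemma expSinc_zero : expSinc 0 = 1 := by
  rw [expSinc, dslope_same, (hasDerivAt_expSubOne 0).deriv]
  simp

lemma expSinc_intCast {n : ℤ} (hn : n ≠ 0) : expSinc n = 0 := by
  have h := mul_expSinc n
  rw [expSubOne_eq_zero_iff.2 ⟨n, rfl⟩] at h
  exact (mul_eq_zero.1 h).resolve_left
    (mul_ne_zero two_pi_I_ne_zero (Int.cast_ne_zero.2 hn))

/-- The slope of an entire function of exponential growth `expWeight` decays like `1 / |z|`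
relative to that weight. -/
lemma exists_norm_dslope_le {G : ℂ → ℂ} (hG : Differentiable ℂ G) (p : ℂ) {C : ℝ}
    (hC : ∀ z, ‖G z - G p‖ ≤ C * expWeight z) :
    ∃ K, 0 ≤ K ∧ ∀ z, ‖dslope G p z‖ ≤ K * expWeight z / (1 + ‖z - p‖) := by
  obtain ⟨B, hB⟩ := (isCompact_closedBall p 1).exists_bound_of_continuousOn
    (hG.dslope p).continuous.continuousOn
  have hC0 : 0 ≤ C := by
    have := hC p
    rw [sub_self, norm_zero] at this
    exact nonneg_of_mul_nonneg_left this (zero_lt_one.trans_le (one_le_expWeight p))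
  have hB0 : 0 ≤ B := (norm_nonneg _).trans (hB p (by simp))
  refine ⟨2 * (B + C), by positivity, fun z => ?_⟩
  have hw := one_le_expWeight z
  have hn := norm_nonneg (z - p)
  rw [le_div_iff₀ (by positivity)]
  rcases le_total ‖z - p‖ 1 with h | h
  · have := hB z (by simpa [dist_eq_norm] using h)
    calc ‖dslope G p z‖ * (1 + ‖z - p‖) ≤ B * 2 := by gcongr; linarith
      _ ≤ 2 * (B + C) * 1 := by linarith
      _ ≤ _ := by gcongr
  · have h1 : ‖z - p‖ * ‖dslope G p z‖ ≤ C * expWeight z := by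
      rw [← norm_mul, ← smul_eq_mul, sub_smul_dslope]
      exact hC z
    calc ‖dslope G p z‖ * (1 + ‖z - p‖) ≤ ‖dslope G p z‖ * (2 * ‖z - p‖) := by gcongr; linarith
      _ ≤ 2 * (C * expWeight z) := by linarith
      _ ≤ 2 * (B + C) * expWeight z := by nlinarith

lemma exists_norm_expSinc_le :
    ∃ K, 0 ≤ K ∧ ∀ z, ‖expSinc z‖ ≤ K * expWeight z / (1 + ‖z‖) := by
  have h0 : expSubOne 0 = 0 := expSubOne_eq_zero_iff.2 ⟨0, by simp⟩
  obtain ⟨K, hK, h⟩ := exists_norm_dslope_le differentiable_expSubOne 0 (C := 1)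
    (fun z => by simpa [h0] using norm_expSubOne_le z)
  refine ⟨K / ‖(2 * Real.pi * I : ℂ)‖, by positivity, fun z => ?_⟩
  rw [expSinc, norm_div, div_mul_eq_mul_div, div_right_comm]
  gcongr
  simpa using h z

/-- Parseval's identity for the samples of `expSinc`. -/
lemma hasSum_norm_expSinc_sq (w : ℝ) : HasSum (fun n : ℤ => ‖expSinc (w - n)‖ ^ 2) 1 := by
  set e : ℝ → ℂ := fun t => exp (2 * Real.pi * I * w * t) with he
  have hec : Continuous e := by fun_prop
  have hnorm : ∀ t, ‖e t‖ = 1 := fun t => by simp [he, Complex.norm_exp]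
  have h := hasSum_sq_fourierCoeffOn (a := 0) (b := 1) (f := e) zero_lt_one
    ((memLp_top_of_bound hec.aestronglyMeasurable 1 (by simp [hnorm])).mono_exponent le_top)
  have hint : ((1 : ℝ) - 0)⁻¹ • ∫ x in (0 : ℝ)..1, ‖e x‖ ^ 2 = 1 := by simp [hnorm]
  rw [hint] at h
  convert h using 4 with n
  rw [fourierCoeffOn_eq_integral]
  have hi : ∀ x : ℝ, fourier (-n) (x : AddCircle ((1 : ℝ) - 0)) • e x =
      exp (2 * Real.pi * I * (w - n) * x) := fun x => by
    rw [fourier_coe_apply, he, smul_eq_mul, ← Complex.exp_add]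
    congr 1
    push_cast
    ring
  simp only [hi]
  by_cases hwn : (w : ℂ) - n = 0
  · simp [hwn, expSinc_zero]
  · have hne : 2 * Real.pi * I * ((w : ℂ) - n) ≠ 0 := mul_ne_zero two_pi_I_ne_zero hwn
    rw [integral_exp_mul_complex hne]
    have := mul_expSinc (w - n)
    rw [expSubOne] at this
    simp only [sub_zero, div_one, one_smul, ofReal_one, mul_one, ofReal_zero, mul_zero,
      Complex.exp_zero]
    rw [eq_div_iff hne, ← this, mul_comm]

/-- A quotient of entire functions is entire when the denominator has only simple zeros and the
numerator vanishes at each of them. -/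
lemma exists_differentiable_mul_eq {D E : ℂ → ℂ} (hD : Differentiable ℂ D)
    (hE : Differentiable ℂ E) (hE' : ∀ z, E z = 0 → deriv E z ≠ 0)
    (h0 : ∀ z, E z = 0 → D z = 0) :
    ∃ Q : ℂ → ℂ, Differentiable ℂ Q ∧ ∀ z, Q z * E z = D z := by
  classical
  have hev : ∀ c, E c = 0 → ∀ᶠ z in 𝓝 c, dslope E c z ≠ 0 := fun c hc =>
    (hE.dslope c).continuous.continuousAt.eventually_ne (by rw [dslope_same]; exact hE' c hc)
  refine ⟨fun z => if E z = 0 then deriv D z / deriv E z else D z / E z, fun c => ?_, fun z => ?_⟩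
  · by_cases hc : E c = 0
    · have hd : DifferentiableAt ℂ (fun z => dslope D c z / dslope E c z) c :=
        (hD.dslope c c).div (hE.dslope c c) (hev c hc).self_of_nhds
      refine hd.congr_of_eventuallyEq ?_
      filter_upwards [hev c hc] with z hz
      have hDz := sub_smul_dslope D c z
      have hEz := sub_smul_dslope E c z
      rw [h0 c hc, sub_zero, smul_eq_mul] at hDz
      rw [hc, sub_zero, smul_eq_mul] at hEz
      by_cases hzc : z = c
      · subst hzc
        simp [hc]
      · have hsub : z - c ≠ 0 := sub_ne_zero.2 hzc
        rw [if_neg (by rw [← hEz]; exact mul_ne_zero hsub hz), ← hDz, ← hEz,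
          mul_div_mul_left _ _ hsub]
    · refine ((hD c).div (hE c) hc).congr_of_eventuallyEq ?_
      filter_upwards [hE.continuous.continuousAt.eventually_ne hc] with z hz
      simp [hz]
  · by_cases hz : E z = 0
    · simp [hz, h0 z hz]
    · simp [hz]

lemma summable_inv_one_add_abs_int_sq : Summable fun n : ℤ => ((1 + |(n : ℝ)|) ^ 2)⁻¹ := by
  have h : Summable fun n : ℕ => ((1 + (n : ℝ)) ^ 2)⁻¹ := by
    have := (summable_nat_add_iff 1).2 (Real.summable_nat_pow_inv.2 one_lt_two)
    simpa [add_comm] using this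
  refine Summable.of_nat_of_neg ?_ ?_ <;> simpa using h

lemma expWeight_le_four_mul_norm_expSubOne_of_one_le_abs_im {z : ℂ} (hz : 1 ≤ |z.im|) :
    expWeight z ≤ 4 * ‖expSubOne z‖ := by
  have hpi := Real.pi_gt_three
  have h := abs_norm_sub_norm_le (exp (2 * Real.pi * I * z)) 1
  rw [norm_exp_two_pi_I_mul, norm_one] at h
  have h' := abs_le.1 h
  rw [expWeight, expSubOne]
  rcases le_abs'.1 hz with hz | hz
  · have : 2 ≤ Real.exp (-(2 * Real.pi * z.im)) := by
      have := Real.add_one_le_exp (-(2 * Real.pi * z.im))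
      nlinarith
    linarith
  · have : 2 ≤ Real.exp (2 * Real.pi * z.im) := by
      have := Real.add_one_le_exp (2 * Real.pi * z.im)
      nlinarith
    have : Real.exp (-(2 * Real.pi * z.im)) ≤ 1 / 2 := by
      rw [Real.exp_neg, one_div]
      exact inv_anti₀ two_pos this
    linarith

lemma norm_expSubOne_eq_of_re_eq {z : ℂ} {k : ℤ} (hz : z.re = k + 1 / 2) :
    ‖expSubOne z‖ = expWeight z := by
  have h : exp (2 * Real.pi * I * z) = -(Real.exp (-(2 * Real.pi * z.im)) : ℝ) := by
    have : 2 * Real.pi * I * z =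
        ((-(2 * Real.pi * z.im) : ℝ) : ℂ) + Real.pi * I + k * (2 * Real.pi * I) := by
      apply Complex.ext
      · simp
      · simp [hz]; ring
    rw [this, Complex.exp_add, Complex.exp_int_mul_two_pi_mul_I, Complex.exp_add,
      Complex.exp_pi_mul_I, Complex.ofReal_exp]
    ring
  rw [expSubOne, h, expWeight, ← neg_add', norm_neg, ← ofReal_one, ← ofReal_add, norm_real,
    Real.norm_of_nonneg (by positivity), add_comm]

/-- An entire function that is bounded on the horizontal region `1 ≤ |Im z|` and on the vertical
lines through the half-integers is bounded by the same constant everywhere. -/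
lemma norm_le_of_norm_le_of_abs_im_or_re {Q : ℂ → ℂ} (hQ : Differentiable ℂ Q) {B : ℝ}
    (him : ∀ z : ℂ, 1 ≤ |z.im| → ‖Q z‖ ≤ B)
    (hre : ∀ (z : ℂ) (k : ℤ), z.re = k + 1 / 2 → ‖Q z‖ ≤ B) (z : ℂ) : ‖Q z‖ ≤ B := by
  rcases le_total 1 |z.im| with h | h
  · exact him z h
  set k : ℤ := ⌊z.re - 1 / 2⌋
  have hk := Int.floor_le (z.re - 1 / 2)
  have hk' := Int.lt_floor_add_one (z.re - 1 / 2)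
  have hab : (k : ℝ) + 1 / 2 < (k + 1 : ℤ) + 1 / 2 := by push_cast; linarith
  refine Complex.norm_le_of_forall_mem_frontier_norm_le
    (U := Set.Ioo ((k : ℝ) + 1 / 2) ((k + 1 : ℤ) + 1 / 2) ×ℂ Set.Ioo (-1) 1)
    ((Metric.isBounded_Ioo _ _).reProdIm (Metric.isBounded_Ioo _ _)) hQ.diffContOnCl
    (fun w hw => ?_) ?_
  · rw [frontier_reProdIm, frontier_Ioo hab, frontier_Ioo (by norm_num)] at hw
    rcases hw with ⟨-, hw | hw⟩ | ⟨hw | hw, -⟩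
    · exact him w (by simp [show w.im = -1 from hw])
    · exact him w (by simp [show w.im = 1 from hw])
    · exact hre w k hw
    · exact hre w (k + 1) hw
  · rw [closure_reProdIm, closure_Ioo hab.ne, closure_Ioo (by norm_num)]
    refine ⟨⟨?_, ?_⟩, abs_le.1 h⟩
    · show (k : ℝ) + 1 / 2 ≤ z.re
      linarith
    · show z.re ≤ ((k + 1 : ℤ) : ℝ) + 1 / 2
      push_cast
      linarith

lemma one_add_abs_le_mul (z : ℂ) (n : ℤ) : 1 + |(n : ℝ)| ≤ (1 + ‖z‖) * (1 + ‖z - n‖) := by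
  have h : ‖(n : ℂ)‖ ≤ ‖z‖ + ‖z - n‖ := by
    have := norm_sub_le z (z - n)
    rwa [sub_sub_cancel] at this
  rw [Complex.norm_intCast] at h
  nlinarith [norm_nonneg z, norm_nonneg (z - n)]

/-- The kernel `1 / ((1 + |n|)(1 + |z - n|))` is dominated, uniformly in `z`, by two translates of
a summable sequence. -/
lemma inv_mul_inv_le (z : ℂ) (n : ℤ) :
    (1 + |(n : ℝ)|)⁻¹ * (1 + ‖z - n‖)⁻¹ ≤
      ((1 + |(n : ℝ)|) ^ 2)⁻¹ + 4 * ((1 + |((n - round z.re : ℤ) : ℝ)|) ^ 2)⁻¹ := by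
  set m := round z.re
  have hm := abs_sub_round z.re
  have hre : |z.re - n| ≤ ‖z - n‖ := by simpa using Complex.abs_re_le_norm (z - n)
  have htri : |((n - m : ℤ) : ℝ)| ≤ |z.re - m| + |z.re - n| := by
    have := abs_sub (z.re - m) (z.re - n)
    rw [sub_sub_sub_cancel_left] at this
    push_cast
    exact this
  have hhalf : (1 + |((n - m : ℤ) : ℝ)|) / 2 ≤ 1 + ‖z - n‖ := by
    linarith [abs_nonneg (z.re - n)]
  have hinv : (1 + ‖z - n‖)⁻¹ ≤ 2 * (1 + |((n - m : ℤ) : ℝ)|)⁻¹ := by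
    refine (inv_anti₀ (by positivity) hhalf).trans_eq ?_
    rw [inv_div, div_eq_mul_inv]
  rw [← inv_pow, ← inv_pow]
  have h0 : 0 ≤ (1 + ‖z - n‖)⁻¹ := by positivity
  nlinarith [sq_nonneg ((1 + |(n : ℝ)|)⁻¹ - (1 + ‖z - n‖)⁻¹)]

/-- The sampling theorem: an entire function of exponential type with spectrum in `[0, 2π]` that
decays like `1 / |z|` is the sum of its cardinal series. -/
lemma hasSum_mul_expSinc {g : ℂ → ℂ} (hg : Differentiable ℂ g) {K : ℝ}
    (hK : ∀ z, ‖g z‖ ≤ K * expWeight z / (1 + ‖z‖)) (z : ℂ) :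
    HasSum (fun n : ℤ => g n * expSinc (z - n)) (g z) := by
  obtain ⟨L, hL0, hL⟩ := exists_norm_expSinc_le
  have hK0 : 0 ≤ K := by
    have := (norm_nonneg _).trans (hK 0)
    simpa [expWeight] using this
  set A : ℝ := 2 * K * L
  have hA0 : 0 ≤ A := by positivity
  have hgn : ∀ n : ℤ, ‖g n‖ ≤ 2 * K * (1 + |(n : ℝ)|)⁻¹ := fun n => by
    refine (hK n).trans ?_
    rw [Complex.norm_intCast, div_eq_mul_inv, mul_comm 2 K]
    gcongr
    exact expWeight_le_two (by simp)
  have hterm : ∀ (z : ℂ) (n : ℤ), ‖g n * expSinc (z - n)‖ ≤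
      A * expWeight z * ((1 + |(n : ℝ)|)⁻¹ * (1 + ‖z - n‖)⁻¹) := fun z n => by
    have h := hL (z - n)
    rw [expWeight_sub_intCast, div_eq_mul_inv] at h
    rw [norm_mul]
    refine (mul_le_mul (hgn n) h (norm_nonneg _) (by positivity)).trans_eq ?_
    simp only [A]
    ring
  have hS := summable_inv_one_add_abs_int_sq
  have hlocal : ∀ (R : ℝ) (n : ℤ) (z : ℂ), z ∈ Metric.ball 0 R → ‖g n * expSinc (z - n)‖ ≤
      A * (1 + Real.exp (2 * Real.pi * R)) * (1 + R) * ((1 + |(n : ℝ)|) ^ 2)⁻¹ := fun R n z hz => by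
    have hzR : ‖z‖ ≤ R := by simpa using (Metric.mem_ball.1 hz).le
    have hR : 0 ≤ R := (norm_nonneg _).trans hzR
    have hw : expWeight z ≤ 1 + Real.exp (2 * Real.pi * R) := by
      unfold expWeight
      gcongr
      have := (abs_le.1 ((Complex.abs_im_le_norm z).trans hzR)).1
      nlinarith [Real.pi_pos]
    have hinv : (1 + ‖z - n‖)⁻¹ ≤ (1 + R) * (1 + |(n : ℝ)|)⁻¹ := by
      rw [← div_eq_mul_inv, le_div_iff₀ (by positivity), mul_comm, ← div_eq_mul_inv,
        div_le_iff₀ (by positivity)]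
      exact (one_add_abs_le_mul z n).trans (by gcongr)
    refine (hterm z n).trans ?_
    calc A * expWeight z * ((1 + |(n : ℝ)|)⁻¹ * (1 + ‖z - n‖)⁻¹)
        ≤ A * (1 + Real.exp (2 * Real.pi * R)) *
          ((1 + |(n : ℝ)|)⁻¹ * ((1 + R) * (1 + |(n : ℝ)|)⁻¹)) := by gcongr
      _ = _ := by rw [← inv_pow]; ring
  have hsum : ∀ z, Summable fun n : ℤ => g n * expSinc (z - n) := fun z =>
    Summable.of_norm_bounded (hS.mul_left _) fun n =>
      hlocal (‖z‖ + 1) n z (by simp)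
  have hdiff : Differentiable ℂ fun z => ∑' n : ℤ, g n * expSinc (z - n) := fun z => by
    refine (differentiableOn_tsum_of_summable_norm
      (hS.mul_left (A * (1 + Real.exp (2 * Real.pi * (‖z‖ + 1))) * (1 + (‖z‖ + 1))))
      (fun n => ?_) Metric.isOpen_ball (hlocal (‖z‖ + 1))).differentiableAt
      (Metric.isOpen_ball.mem_nhds (by simp))
    exact ((differentiable_expSinc.comp
      (differentiable_id.sub_const _)).const_mul _).differentiableOn
  obtain ⟨Q, hQ, hQE⟩ := exists_differentiable_mul_eq (hg.sub hdiff) differentiable_expSubOne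
    (fun z _ => deriv_expSubOne_ne_zero z) (fun z hz => by
      obtain ⟨m, rfl⟩ := expSubOne_eq_zero_iff.1 hz
      rw [Pi.sub_apply, sub_eq_zero, tsum_eq_single m]
      · simp [expSinc_zero]
      · intro n hn
        rw [← Int.cast_sub, expSinc_intCast (sub_ne_zero.2 hn.symm), mul_zero])
  have hQle : ∀ z, expWeight z ≤ 4 * ‖expSubOne z‖ →
      ‖Q z‖ ≤ 4 * (K * (1 + ‖z‖)⁻¹ +
        A * ∑' n : ℤ, (1 + |(n : ℝ)|)⁻¹ * (1 + ‖z - n‖)⁻¹) := fun z hz => by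
    have hw : 0 < expWeight z := zero_lt_one.trans_le (one_le_expWeight z)
    have hs : Summable fun n : ℤ => (1 + |(n : ℝ)|)⁻¹ * (1 + ‖z - n‖)⁻¹ :=
      Summable.of_nonneg_of_le (fun n => by positivity) (inv_mul_inv_le z)
        (hS.add (((Equiv.subRight (round z.re)).summable_iff.2 hS).mul_left 4))
    have hD : ‖Q z * expSubOne z‖ ≤ expWeight z * (K * (1 + ‖z‖)⁻¹ +
        A * ∑' n : ℤ, (1 + |(n : ℝ)|)⁻¹ * (1 + ‖z - n‖)⁻¹) := by
      rw [hQE, Pi.sub_apply]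
      refine (norm_sub_le _ _).trans ?_
      rw [mul_add]
      refine add_le_add ((hK z).trans_eq (by ring)) ?_
      refine (tsum_of_norm_bounded ((hs.mul_left (A * expWeight z)).hasSum) (hterm z)).trans_eq ?_
      rw [tsum_mul_left]
      ring
    rw [norm_mul] at hD
    refine le_of_mul_le_mul_left ?_ hw
    nlinarith [norm_nonneg (Q z)]
  have htsum : ∀ z : ℂ, ∑' n : ℤ, (1 + |(n : ℝ)|)⁻¹ * (1 + ‖z - n‖)⁻¹ ≤
      5 * ∑' n : ℤ, ((1 + |(n : ℝ)|) ^ 2)⁻¹ := fun z => by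
    have hsh := (Equiv.subRight (round z.re)).hasSum_iff.2 hS.hasSum
    have hB := hS.hasSum.add (hsh.mul_left 4)
    refine (Summable.tsum_le_tsum (inv_mul_inv_le z)
      (Summable.of_nonneg_of_le (fun n => by positivity) (inv_mul_inv_le z) hB.summable)
      hB.summable).trans_eq (hB.tsum_eq.trans (by ring))
  have hQbdd : ∀ z, ‖Q z‖ ≤ 4 * (K + A * (5 * ∑' n : ℤ, ((1 + |(n : ℝ)|) ^ 2)⁻¹)) := by
    have hgood : ∀ z, expWeight z ≤ 4 * ‖expSubOne z‖ →
        ‖Q z‖ ≤ 4 * (K + A * (5 * ∑' n : ℤ, ((1 + |(n : ℝ)|) ^ 2)⁻¹)) := fun z hz => by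
      refine (hQle z hz).trans ?_
      gcongr
      · exact mul_le_of_le_one_right hK0 (inv_le_one_of_one_le₀ (by linarith [norm_nonneg z]))
      · exact htsum z
    refine norm_le_of_norm_le_of_abs_im_or_re hQ
      (fun z hz => hgood z (expWeight_le_four_mul_norm_expSubOne_of_one_le_abs_im hz))
      (fun z k hz => hgood z ?_)
    rw [norm_expSubOne_eq_of_re_eq hz]
    linarith [one_le_expWeight z]
  have hconst : ∀ z w, Q z = Q w := hQ.apply_eq_apply_of_bounded
    (isBounded_iff_forall_norm_le.2 ⟨_, Set.forall_mem_range.2 hQbdd⟩)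
  have hinv : ∀ z₀ : ℂ, Tendsto (fun y : ℝ => (1 + ‖(y : ℂ) * I - z₀‖)⁻¹) atTop (𝓝 0) :=
      fun z₀ => by
    refine tendsto_inv_atTop_zero.comp (tendsto_atTop_mono (fun y => ?_)
      (tendsto_atTop_add_const_right _ (-‖z₀‖) tendsto_id))
    have h1 := norm_sub_norm_le ((y : ℂ) * I) z₀
    have h2 := le_abs_self y
    simp only [norm_mul, norm_real, Real.norm_eq_abs, norm_I, mul_one] at h1
    simp only [id]
    linarith
  have hlim : Tendsto (fun y : ℝ => 4 * (K * (1 + ‖(y : ℂ) * I‖)⁻¹ +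
      A * ∑' n : ℤ, (1 + |(n : ℝ)|)⁻¹ * (1 + ‖(y : ℂ) * I - n‖)⁻¹)) atTop (𝓝 0) := by
    have ht : Tendsto (fun y : ℝ => ∑' n : ℤ, (1 + |(n : ℝ)|)⁻¹ * (1 + ‖(y : ℂ) * I - n‖)⁻¹)
        atTop (𝓝 (∑' _ : ℤ, (0 : ℝ))) := by
      refine tendsto_tsum_of_dominated_convergence hS
        (fun n => by simpa using (hinv n).const_mul _) (Eventually.of_forall fun y n => ?_)
      have h1 : |(n : ℝ)| ≤ ‖(y : ℂ) * I - n‖ := by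
        simpa using Complex.abs_re_le_norm ((y : ℂ) * I - n)
      rw [Real.norm_of_nonneg (by positivity), ← inv_pow, sq]
      gcongr
    rw [tsum_zero] at ht
    simpa using ((((hinv 0).const_mul K).add (ht.const_mul A)).const_mul 4)
  have hQ0 : ‖Q z‖ ≤ 0 := by
    refine ge_of_tendsto hlim ?_
    filter_upwards [eventually_ge_atTop 1] with y hy
    rw [hconst z (y * I)]
    exact hQle _ (expWeight_le_four_mul_norm_expSubOne_of_one_le_abs_im
      (by simpa using hy.trans (le_abs_self y)))
  have hz := hQE z
  rw [norm_le_zero_iff.1 hQ0, zero_mul, Pi.sub_apply] at hz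
  rw [sub_eq_zero.1 hz.symm]
  exact (hsum z).hasSum

/-- The sampling nodes `2π(n - 1/2)/σ`, which avoid the origin. -/
noncomputable def sampleNode (σ : ℝ) (n : ℤ) : ℝ := 2 * Real.pi / σ * (n - 1 / 2)

/-- The weight `z κ(z) = z / (1 - iz)` times the cardinal function of the `n`-th sampling node. -/
noncomputable def sampleFun (σ : ℝ) (n : ℤ) (z : ℂ) : ℂ :=
  z * (1 - I * z)⁻¹ * expSinc (σ * z / (2 * Real.pi) + 1 / 2 - n)

lemma intCast_sub_half_ne_zero (n : ℤ) : (n : ℝ) - 1 / 2 ≠ 0 := by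
  intro h
  have h2 : ((2 * n : ℤ) : ℝ) = (1 : ℤ) := by push_cast; linarith
  have := Int.cast_injective h2
  omega

lemma sampleNode_ne_zero {σ : ℝ} (hσ : σ ≠ 0) (n : ℤ) : sampleNode σ n ≠ 0 :=
  mul_ne_zero (div_ne_zero (mul_ne_zero two_ne_zero Real.pi_ne_zero) hσ)
    (intCast_sub_half_ne_zero n)

/-- Evaluating Parseval's identity at `1/2` gives the sum of the inverse squares of the nodes. -/
lemma hasSum_inv_sampleNode_sq {σ : ℝ} (hσ : σ ≠ 0) :
    HasSum (fun n : ℤ => (sampleNode σ n ^ 2)⁻¹) (σ ^ 2 / 4) := by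
  have h := (hasSum_norm_expSinc_sq (1 / 2)).mul_left (σ ^ 2 / 4)
  rw [mul_one] at h
  refine h.congr_fun fun n => ?_
  have hn := intCast_sub_half_ne_zero n
  have h1 := congrArg norm (mul_expSinc (((1 / 2 : ℝ) : ℂ) - n))
  rw [norm_expSubOne_eq_of_re_eq (k := -n) (by simp; ring), norm_mul, ← ofReal_intCast,
    ← ofReal_sub, norm_mul, norm_real, Real.norm_eq_abs] at h1
  have h2 : ‖(2 * Real.pi * I : ℂ)‖ = 2 * Real.pi := by simp [abs_of_pos Real.pi_pos]
  have h3 : expWeight ((1 / 2 - (n : ℝ) : ℝ) : ℂ) = 2 := by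
    simp only [expWeight, ofReal_im]; norm_num
  rw [h2, h3] at h1
  have h4 := congrArg (· ^ 2) h1
  simp only [mul_pow, sq_abs] at h4
  have hpi := Real.pi_ne_zero
  rw [sampleNode, ← ofReal_intCast]
  have h5 : ‖expSinc (((1 / 2 : ℝ) : ℂ) - (n : ℝ))‖ ^ 2 =
      1 / (Real.pi ^ 2 * ((n : ℝ) - 1 / 2) ^ 2) := by
    rw [eq_div_iff (by positivity)]
    push_cast at h4 ⊢
    linear_combination h4 / 4
  rw [h5]
  field_simp
  norm_num

/-- Sampling of the difference quotient at the origin of a function in `(ℰ_σ^∞)₊`. -/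
lemma MemEInftyPlus.hasSum_sample {σ : ℝ} (hσ : 0 < σ) {F : ℂ → ℂ} (hF : MemEInftyPlus σ F)
    (x : ℝ) :
    HasSum (fun n : ℤ => x * expSinc (σ * x / (2 * Real.pi) + 1 / 2 - n) *
      ((F (sampleNode σ n) - F 0) / sampleNode σ n)) (F x - F 0) := by
  obtain ⟨hd, ⟨C₁, hC₁⟩, ⟨C₂, hC₂⟩⟩ := hF
  have hpi := Real.pi_pos
  have hpiC : (Real.pi : ℂ) ≠ 0 := ofReal_ne_zero.2 hpi.ne'
  have hσC : (σ : ℂ) ≠ 0 := ofReal_ne_zero.2 hσ.ne'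
  have hC₁0 : 0 ≤ C₁ := (norm_nonneg _).trans (hC₁ 0 le_rfl)
  have hC₂0 : 0 ≤ C₂ := (norm_nonneg _).trans (hC₂ 0 le_rfl)
  set c : ℝ := 2 * Real.pi / σ with hc
  set p : ℂ := 1 / 2 with hp
  set G : ℂ → ℂ := fun w => F (c * (w - p)) with hG
  have hGd : Differentiable ℂ G :=
    hd.comp ((differentiable_id.sub_const p).const_mul (c : ℂ))
  have hGle : ∀ w, ‖G w‖ ≤ (C₁ + C₂) * expWeight w := fun w => by
    have him : ((c : ℂ) * (w - p)).im = c * w.im := by simp [hp]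
    have hw := one_le_expWeight w
    rcases le_total 0 w.im with h | h
    · have := hC₁ (c * (w - p)) (by rw [him]; positivity)
      simp only [hG]
      nlinarith
    · have h2 := hC₂ (c * (w - p)) (him.trans_le
        (mul_nonpos_of_nonneg_of_nonpos (by positivity) h))
      have hexp : ‖exp (-(I * σ * (c * (w - p))))‖ = Real.exp (2 * Real.pi * w.im) := by
        have hre : (-(I * σ * (c * (w - p)))).re = σ * ((c : ℂ) * (w - p)).im := by simp
        rw [Complex.norm_exp, hre, him, hc]
        congr 1
        field_simp
      rw [norm_mul, hexp] at h2
      have h3 : ‖G w‖ ≤ C₂ * Real.exp (-(2 * Real.pi * w.im)) := by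
        rw [Real.exp_neg, ← div_eq_mul_inv, le_div_iff₀ (Real.exp_pos _), mul_comm]
        exact h2
      refine h3.trans ?_
      unfold expWeight
      have := Real.exp_pos (-(2 * Real.pi * w.im))
      nlinarith
  obtain ⟨K, hK0, hK⟩ := exists_norm_dslope_le hGd p (C := 3 * (C₁ + C₂)) fun w => by
    have h1 := hGle w
    have h2 := hGle p
    have h3 : expWeight p ≤ 2 := expWeight_le_two (by simp [hp])
    have h4 := one_le_expWeight w
    have h5 := norm_sub_le (G w) (G p)
    nlinarith
  have hK' : ∀ w, ‖dslope G p w‖ ≤ (2 * K) * expWeight w / (1 + ‖w‖) := fun w => by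
    refine (hK w).trans ?_
    have hw := one_le_expWeight w
    have h1 : 1 + ‖w‖ ≤ 2 * (1 + ‖w - p‖) := by
      have := norm_sub_norm_le w p
      have h2 : ‖p‖ = 1 / 2 := by simp [hp]
      linarith [norm_nonneg (w - p)]
    rw [div_le_div_iff₀ (by positivity) (by positivity)]
    have h2 : 0 ≤ K * expWeight w := by positivity
    nlinarith
  set w : ℂ := σ * x / (2 * Real.pi) + 1 / 2 with hw
  have hsum := (hasSum_mul_expSinc (hGd.dslope p) hK' w).mul_left (w - p)
  have hFx : (w - p) * dslope G p w = F x - F 0 := by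
    rw [← smul_eq_mul, sub_smul_dslope]
    have h1 : (c : ℂ) * (w - p) = x := by
      rw [hw, hp, hc]
      push_cast
      field_simp
      ring
    simp only [hG, h1, sub_self, mul_zero]
  rw [hFx] at hsum
  refine hsum.congr_fun fun n => ?_
  have hn : (n : ℂ) - p ≠ 0 := by
    have := ofReal_ne_zero.2 (intCast_sub_half_ne_zero n)
    simpa [hp] using this
  have hnode : (sampleNode σ n : ℂ) = c * (n - p) := by
    rw [sampleNode, hp, hc]
    push_cast
    ring
  have hcC : (c : ℂ) ≠ 0 := ofReal_ne_zero.2 (by positivity)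
  have hGn : dslope G p n = (F (sampleNode σ n) - F 0) / (n - p) := by
    rw [eq_div_iff hn, mul_comm, ← smul_eq_mul, sub_smul_dslope]
    simp only [hG, hnode, sub_self, mul_zero]
  have hwp : w - p = x / c := by
    rw [hw, hp, hc]
    push_cast
    field_simp
    ring
  rw [hGn, hwp, hnode]
  field_simp

lemma one_sub_I_mul_ne_zero {z : ℂ} (hz : 0 ≤ z.im) : 1 - I * z ≠ 0 := by
  intro h
  have := congrArg Complex.re h
  simp at this
  linarith

lemma one_add_norm_sq_le_norm_one_sub_I_mul_sq {z : ℂ} (hz : 0 ≤ z.im) :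
    1 + ‖z‖ ^ 2 ≤ ‖1 - I * z‖ ^ 2 := by
  rw [Complex.sq_norm, Complex.sq_norm, Complex.normSq_apply, Complex.normSq_apply]
  simp
  nlinarith

lemma norm_inv_one_sub_I_mul_le {z : ℂ} (hz : 0 ≤ z.im) : ‖(1 - I * z)⁻¹‖ ≤ 1 := by
  rw [norm_inv]
  refine inv_le_one_of_one_le₀ (abs_le_of_sq_le_sq' ?_ (norm_nonneg _)).2
  nlinarith [one_add_norm_sq_le_norm_one_sub_I_mul_sq hz, sq_nonneg ‖z‖]

lemma norm_mul_inv_one_sub_I_mul_le {z : ℂ} (hz : 0 ≤ z.im) : ‖z * (1 - I * z)⁻¹‖ ≤ 1 := by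
  rw [norm_mul, norm_inv, ← div_eq_mul_inv]
  refine div_le_one_of_le₀ (abs_le_of_sq_le_sq' ?_ (norm_nonneg _)).2 (norm_nonneg _)
  linarith [one_add_norm_sq_le_norm_one_sub_I_mul_sq hz]

lemma norm_one_sub_I_mul_ofReal_sq (x : ℝ) : ‖1 - I * (x : ℂ)‖ ^ 2 = 1 + x ^ 2 := by
  rw [Complex.sq_norm, Complex.normSq_apply]
  simp
  ring

lemma differentiableAt_inv_one_sub_I_mul {z : ℂ} (hz : 0 ≤ z.im) :
    DifferentiableAt ℂ (fun z : ℂ => (1 - I * z)⁻¹) z :=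
  ((differentiableAt_id.const_mul I).const_sub 1).inv (one_sub_I_mul_ne_zero hz)

lemma differentiableAt_sampleFun (σ : ℝ) (n : ℤ) {z : ℂ} (hz : 0 ≤ z.im) :
    DifferentiableAt ℂ (sampleFun σ n) z := by
  refine (differentiableAt_id.mul (differentiableAt_inv_one_sub_I_mul hz)).mul
    (differentiable_expSinc.differentiableAt.comp z ?_)
  fun_prop

lemma exists_norm_sampleFun_le {σ : ℝ} (hσ : 0 < σ) (n : ℤ) :
    ∃ C, ∀ z : ℂ, 0 ≤ z.im → ‖sampleFun σ n z‖ ≤ C := by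
  obtain ⟨K, hK0, hK⟩ := exists_norm_expSinc_le
  refine ⟨K * 2, fun z hz => ?_⟩
  rw [sampleFun, norm_mul]
  refine (mul_le_of_le_one_left (norm_nonneg _) (norm_mul_inv_one_sub_I_mul_le hz)).trans ?_
  refine (hK _).trans ?_
  rw [expWeight_sub_intCast]
  refine (div_le_self (mul_nonneg hK0 (zero_le_one.trans (one_le_expWeight _)))
    (by linarith [norm_nonneg (σ * z / (2 * Real.pi) + 1 / 2 - n)])).trans ?_
  gcongr
  refine expWeight_le_two ?_
  have : (σ * z / (2 * Real.pi) + 1 / 2 : ℂ) = ((σ / (2 * Real.pi) : ℝ) : ℂ) * z + (1 / 2 : ℝ) := by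
    push_cast
    ring
  rw [this, add_im, ofReal_im, im_ofReal_mul, add_zero]
  have := Real.pi_pos
  positivity

lemma hasSum_norm_sampleFun_sq (σ x : ℝ) :
    HasSum (fun n : ℤ => ‖sampleFun σ n x‖ ^ 2) (x ^ 2 / (1 + x ^ 2)) := by
  have h := (hasSum_norm_expSinc_sq (σ * x / (2 * Real.pi) + 1 / 2)).mul_left (x ^ 2 / (1 + x ^ 2))
  rw [mul_one] at h
  refine h.congr_fun fun n => ?_
  rw [sampleFun, norm_mul, norm_mul, mul_pow, mul_pow, norm_inv, inv_pow,
    norm_one_sub_I_mul_ofReal_sq, norm_real, Real.norm_eq_abs, sq_abs, div_eq_mul_inv]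
  push_cast
  rfl

/-- For `f` sectionally in `(ℰ_σ^∞)₊(ℝ²)` bounded by `M` and `κ(x) = (1 − ix)⁻¹`, the
function `(x, y) ↦ κ(x) f(x, y)` admits a Haagerup factorization
`κ(x) f(x,y) = ∑_n φₙ(x) ψₙ(y)` where each `φₙ`, `ψₙ` is the restriction to `ℝ` of a
function continuous on the closed upper half-plane and bounded and analytic in the open
upper half-plane, with
`(sup_x ∑ |φₙ(x)|²)^{1/2} (sup_y ∑ |ψₙ(y)|²)^{1/2} ≤ ((2/√π)σ + 1) M`. -/
theorem kappa_mul_haagerup_factorization (σ : ℝ) (hσ : 0 < σ) (f : ℂ → ℂ → ℂ)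
    (hf : SectEInftyPlus σ f) (M : ℝ) (hM : ∀ x y : ℝ, ‖f (x : ℂ) (y : ℂ)‖ ≤ M) :
    ∃ φ ψ : ℕ → ℝ → ℂ,
      (∀ n : ℕ, ∃ Φ : ℂ → ℂ, (∀ t : ℝ, φ n t = Φ (t : ℂ)) ∧
        ContinuousOn Φ {z : ℂ | 0 ≤ z.im} ∧ DifferentiableOn ℂ Φ {z : ℂ | 0 < z.im} ∧
        ∃ C : ℝ, ∀ z : ℂ, 0 ≤ z.im → ‖Φ z‖ ≤ C) ∧
      (∀ n : ℕ, ∃ Ψ : ℂ → ℂ, (∀ t : ℝ, ψ n t = Ψ (t : ℂ)) ∧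
        ContinuousOn Ψ {z : ℂ | 0 ≤ z.im} ∧ DifferentiableOn ℂ Ψ {z : ℂ | 0 < z.im} ∧
        ∃ C : ℝ, ∀ z : ℂ, 0 ≤ z.im → ‖Ψ z‖ ≤ C) ∧
      (∀ x y : ℝ,
        Summable (fun n : ℕ => ‖φ n x * ψ n y‖) ∧
        HasSum (fun n : ℕ => φ n x * ψ n y)
          ((1 - Complex.I * (x : ℂ))⁻¹ * f (x : ℂ) (y : ℂ))) ∧
      ∃ A B : ℝ, 0 ≤ A ∧ 0 ≤ B ∧
        (∀ x : ℝ, ∃ Sx : ℝ, HasSum (fun n : ℕ => ‖φ n x‖ ^ 2) Sx ∧ Sx ≤ A) ∧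
        (∀ y : ℝ, ∃ Sy : ℝ, HasSum (fun n : ℕ => ‖ψ n y‖ ^ 2) Sy ∧ Sy ≤ B) ∧
        Real.sqrt A * Real.sqrt B ≤ ((2 / Real.sqrt Real.pi) * σ + 1) * M := by
  have hM0 : 0 ≤ M := (norm_nonneg _).trans (hM 0 0)
  obtain ⟨e⟩ : Nonempty (ℕ ≃ ℤ ⊕ Unit) :=
    ⟨(Denumerable.eqv (Option ℤ)).symm.trans (Equiv.optionEquivSumPUnit ℤ)⟩
  let Φ : ℤ ⊕ Unit → ℂ → ℂ := Sum.elim (sampleFun σ) fun _ z => (1 - I * z)⁻¹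
  let Ψ : ℤ ⊕ Unit → ℂ → ℂ :=
    Sum.elim (fun n z => (f (sampleNode σ n) z - f 0 z) / sampleNode σ n) fun _ z => f 0 z
  have hΦd : ∀ i z, 0 ≤ z.im → DifferentiableAt ℂ (Φ i) z := by
    rintro (n | _) z hz
    · exact differentiableAt_sampleFun σ n hz
    · exact differentiableAt_inv_one_sub_I_mul hz
  have hΦb : ∀ i, ∃ C : ℝ, ∀ z : ℂ, 0 ≤ z.im → ‖Φ i z‖ ≤ C := by
    rintro (n | _)
    · exact exists_norm_sampleFun_le hσ n
    · exact ⟨1, fun z hz => norm_inv_one_sub_I_mul_le hz⟩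
  have h0 : MemEInftyPlus σ (f 0) := by simpa using (hf 0).2
  have hΨd : ∀ i, Differentiable ℂ (Ψ i) := by
    rintro (n | _)
    · exact ((hf (sampleNode σ n)).2.1.sub h0.1).div_const _
    · exact h0.1
  have hΨb : ∀ i, ∃ C : ℝ, ∀ z : ℂ, 0 ≤ z.im → ‖Ψ i z‖ ≤ C := by
    obtain ⟨C₀, hC₀⟩ := h0.2.1
    rintro (n | _)
    · obtain ⟨C, hC⟩ := (hf (sampleNode σ n)).2.2.1
      refine ⟨(C + C₀) / ‖(sampleNode σ n : ℂ)‖, fun z hz => ?_⟩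
      simp only [Ψ, Sum.elim_inl, norm_div]
      gcongr
      exact (norm_sub_le _ _).trans (add_le_add (hC z hz) (hC₀ z hz))
    · exact ⟨C₀, hC₀⟩
  have hΦsq : ∀ x : ℝ, HasSum (fun i => ‖Φ i x‖ ^ 2) 1 := fun x => by
    have h := HasSum.sum (f := fun i => ‖Φ i x‖ ^ 2) (hasSum_norm_sampleFun_sq σ x)
      (hasSum_unique _)
    convert h using 1
    have hx : 1 + x ^ 2 ≠ 0 := by positivity
    simp only [Φ, Function.comp_apply, Sum.elim_inr, norm_inv, inv_pow,
      norm_one_sub_I_mul_ofReal_sq]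
    field_simp
    ring
  have hΨsq : ∀ y : ℝ, ∃ S : ℝ, HasSum (fun i => ‖Ψ i y‖ ^ 2) S ∧ S ≤ (σ ^ 2 + 1) * M ^ 2 :=
      fun y => by
    have hB := (hasSum_inv_sampleNode_sq hσ.ne').mul_left (4 * M ^ 2)
    have hf0 : ‖f 0 y‖ ≤ M := by simpa using hM 0 y
    have hle : ∀ n : ℤ, ‖Ψ (Sum.inl n) y‖ ^ 2 ≤ 4 * M ^ 2 * (sampleNode σ n ^ 2)⁻¹ := fun n => by
      simp only [Ψ, Sum.elim_inl]
      rw [norm_div, div_pow, norm_real, Real.norm_eq_abs, sq_abs, div_eq_mul_inv]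
      gcongr
      calc ‖f (sampleNode σ n) y - f 0 y‖ ^ 2 ≤ (M + M) ^ 2 := by
            gcongr
            exact (norm_sub_le _ _).trans (add_le_add (hM _ _) hf0)
        _ = 4 * M ^ 2 := by ring
    have hs : Summable fun n : ℤ => ‖Ψ (Sum.inl n) y‖ ^ 2 :=
      Summable.of_nonneg_of_le (fun n => by positivity) hle hB.summable
    refine ⟨_, HasSum.sum (f := fun i => ‖Ψ i y‖ ^ 2) hs.hasSum (hasSum_unique _), ?_⟩
    have h1 := hasSum_le hle hs.hasSum hB
    have h2 : ‖f 0 y‖ ^ 2 ≤ M ^ 2 := by gcongr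
    calc _ ≤ 4 * M ^ 2 * (σ ^ 2 / 4) + M ^ 2 := add_le_add h1 h2
      _ = _ := by ring
  have hprod : ∀ x y : ℝ, HasSum (fun i => Φ i x * Ψ i y) ((1 - I * (x : ℂ))⁻¹ * f x y) :=
      fun x y => by
    have h := ((hf y).1.hasSum_sample hσ x).mul_left (1 - I * (x : ℂ))⁻¹
    have h' : HasSum ((fun i => Φ i x * Ψ i y) ∘ Sum.inl)
        ((1 - I * (x : ℂ))⁻¹ * (f x y - f 0 y)) :=
      h.congr_fun fun n => by
        simp only [Φ, Ψ, sampleFun, Function.comp_apply, Sum.elim_inl]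
        ring
    convert HasSum.sum h' (hasSum_unique _) using 1
    simp only [Φ, Ψ, Function.comp_apply, Sum.elim_inr]
    ring
  refine ⟨fun n t => Φ (e n) t, fun n t => Ψ (e n) t,
    fun n => ⟨Φ (e n), fun _ => rfl,
      fun z hz => (hΦd _ z hz).continuousAt.continuousWithinAt,
      fun z hz => (hΦd _ z (le_of_lt hz)).differentiableWithinAt, hΦb _⟩,
    fun n => ⟨Ψ (e n), fun _ => rfl, (hΨd _).continuous.continuousOn,
      (hΨd _).differentiableOn, hΨb _⟩,
    fun x y => ?_, 1, (σ ^ 2 + 1) * M ^ 2, zero_le_one, by positivity,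
    fun x => ⟨1, (e.hasSum_iff (f := fun i => ‖Φ i x‖ ^ 2)).2 (hΦsq x), le_rfl⟩, fun y => ?_, ?_⟩
  · have h := (e.hasSum_iff (f := fun i => Φ i x * Ψ i y)).2 (hprod x y)
    exact ⟨h.summable.norm, h⟩
  · obtain ⟨S, hS, hSle⟩ := hΨsq y
    exact ⟨S, (e.hasSum_iff (f := fun i => ‖Ψ i y‖ ^ 2)).2 hS, hSle⟩
  · have hpi : 1 ≤ 2 / Real.sqrt Real.pi := by
      rw [le_div_iff₀ (Real.sqrt_pos.2 Real.pi_pos), one_mul]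
      exact Real.sqrt_le_iff.2 ⟨zero_le_two, by linarith [Real.pi_le_four]⟩
    rw [Real.sqrt_one, one_mul]
    refine (Real.sqrt_le_iff.2 ⟨by positivity, ?_⟩ : _ ≤ (σ + 1) * M).trans ?_
    · nlinarith [mul_nonneg hσ.le (sq_nonneg M)]
    · gcongr
      exact le_mul_of_one_le_left hσ.le hpi
end

section
/- Let ω be a modulus of continuity, i.e., a real-valued continuous nondecreasing function on [0, ∞) with ω(s + t) ≤ ω(s) + ω(t) for all s, t ≥ 0, and define ω*(s) = s ∫_s^∞ ω(t)/t² dt for s > 0 (equivalently ω*(s) = ∫_1^∞ ω(st)/t² dt). If ω*(s₀) < ∞ for some s₀ > 0, then ω*(s) < ∞ for every s > 0, and ω* is itself a modulus of continuity on (0, ∞): it is continuous, nondecreasing, and satisfies ω*(s₁ + s₂) ≤ ω*(s₁) + ω*(s₂) for all s₁, s₂ > 0. -/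
open MeasureTheory

theorem integrableOn_Ioi_div_sq_of_continuousOn {ω : ℝ → ℝ}
    (hcont : ContinuousOn ω (Set.Ici (0 : ℝ))) {s₀ : ℝ}
    (h : IntegrableOn (fun t : ℝ => ω t / t ^ 2) (Set.Ioi s₀)) {s : ℝ} (hs : 0 < s) :
    IntegrableOn (fun t : ℝ => ω t / t ^ 2) (Set.Ioi s) := by
  have hc : ContinuousOn (fun t : ℝ => ω t / t ^ 2) (Set.Icc s s₀) := by
    refine (hcont.mono fun t ht => hs.le.trans ht.1).div (by fun_prop) fun t ht => ?_
    exact pow_ne_zero _ (hs.trans_le ht.1).ne'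
  refine (hc.integrableOn_Icc.union h).mono_set fun t ht => ?_
  rcases le_or_gt t s₀ with h' | h'
  · exact Or.inl ⟨le_of_lt ht, h'⟩
  · exact Or.inr h'

theorem comp_mul_left_div_sq_eq (ω : ℝ → ℝ) {s : ℝ} (hs : 0 < s) :
    (fun t : ℝ => ω (s * t) / t ^ 2) = fun t => s ^ 2 * (ω (s * t) / (s * t) ^ 2) := by
  funext t
  rw [mul_pow, ← mul_div_assoc, mul_div_mul_left _ _ (pow_ne_zero 2 hs.ne')]

theorem mul_integral_Ioi_div_sq (ω : ℝ → ℝ) {s : ℝ} (hs : 0 < s) :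
    s * ∫ t in Set.Ioi s, ω t / t ^ 2 = ∫ t in Set.Ioi 1, ω (s * t) / t ^ 2 := by
  have h := integral_comp_mul_left_Ioi (fun t : ℝ => ω t / t ^ 2) 1 hs
  rw [comp_mul_left_div_sq_eq ω hs, integral_const_mul, h, mul_one, smul_eq_mul]
  field_simp

theorem integrableOn_Ioi_one_comp_mul_left_div_sq {ω : ℝ → ℝ} {s : ℝ} (hs : 0 < s)
    (h : IntegrableOn (fun t : ℝ => ω t / t ^ 2) (Set.Ioi s)) :
    IntegrableOn (fun t : ℝ => ω (s * t) / t ^ 2) (Set.Ioi 1) := by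
  rw [comp_mul_left_div_sq_eq ω hs]
  refine Integrable.const_mul ?_ _
  exact (integrableOn_Ioi_comp_mul_left_iff (fun t : ℝ => ω t / t ^ 2) 1 hs).2 (by rwa [mul_one])

/-- Let `ω` be a modulus of continuity (continuous, nondecreasing and subadditive on
`[0, ∞)`), and let `ω*(s) = s ∫_s^∞ ω(t)/t² dt`.  If `ω*(s₀) < ∞` for some `s₀ > 0`
(i.e. `t ↦ ω(t)/t²` is integrable on `(s₀, ∞)`), then `ω*(s) < ∞` for every `s > 0`,
and `ω*` is itself a modulus of continuity on `(0, ∞)`: continuous, nondecreasing and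
subadditive. -/
theorem omegaStar_modulus_of_continuity (ω : ℝ → ℝ)
    (hcont : ContinuousOn ω (Set.Ici (0 : ℝ)))
    (hmono : MonotoneOn ω (Set.Ici (0 : ℝ)))
    (hsub : ∀ s t : ℝ, 0 ≤ s → 0 ≤ t → ω (s + t) ≤ ω s + ω t)
    (hfin : ∃ s₀ : ℝ, 0 < s₀ ∧ IntegrableOn (fun t : ℝ => ω t / t ^ 2) (Set.Ioi s₀)) :
    (∀ s : ℝ, 0 < s → IntegrableOn (fun t : ℝ => ω t / t ^ 2) (Set.Ioi s)) ∧
    ContinuousOn (fun s : ℝ => s * ∫ t in Set.Ioi s, ω t / t ^ 2) (Set.Ioi (0 : ℝ)) ∧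
    MonotoneOn (fun s : ℝ => s * ∫ t in Set.Ioi s, ω t / t ^ 2) (Set.Ioi (0 : ℝ)) ∧
    ∀ s₁ s₂ : ℝ, 0 < s₁ → 0 < s₂ →
      (s₁ + s₂) * ∫ t in Set.Ioi (s₁ + s₂), ω t / t ^ 2
        ≤ s₁ * (∫ t in Set.Ioi s₁, ω t / t ^ 2) + s₂ * ∫ t in Set.Ioi s₂, ω t / t ^ 2 := by
  obtain ⟨s₀, -, h₀⟩ := hfin
  have hint : ∀ s : ℝ, 0 < s → IntegrableOn (fun t : ℝ => ω t / t ^ 2) (Set.Ioi s) :=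
    fun s hs => integrableOn_Ioi_div_sq_of_continuousOn hcont h₀ hs
  have hint' : ∀ s : ℝ, 0 < s → IntegrableOn (fun t : ℝ => ω (s * t) / t ^ 2) (Set.Ioi 1) :=
    fun s hs => integrableOn_Ioi_one_comp_mul_left_div_sq hs (hint s hs)
  refine ⟨hint, ?_, ?_, ?_⟩
  · refine continuousOn_id.mul fun s (hs : 0 < s) => ?_
    have hs' : 0 < s / 2 := half_pos hs
    exact ((hint _ hs').continuousOn_Ici_primitive_Ioi.continuousAt
      (Ici_mem_nhds (half_lt_self hs))).continuousWithinAt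
  · intro a (ha : 0 < a) b (hb : 0 < b) hab
    simp only [mul_integral_Ioi_div_sq ω ha, mul_integral_Ioi_div_sq ω hb]
    refine setIntegral_mono_on (hint' a ha) (hint' b hb) measurableSet_Ioi fun t ht => ?_
    have ht : 0 < t := one_pos.trans ht
    gcongr
    exact hmono (mul_pos ha ht).le (mul_pos hb ht).le (by gcongr)
  · intro a b ha hb
    rw [mul_integral_Ioi_div_sq ω ha, mul_integral_Ioi_div_sq ω hb,
      mul_integral_Ioi_div_sq ω (add_pos ha hb), ← integral_add (hint' a ha) (hint' b hb)]
    refine setIntegral_mono_on (hint' _ (add_pos ha hb)) ((hint' a ha).add (hint' b hb))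
      measurableSet_Ioi fun t ht => ?_
    have ht : 0 < t := one_pos.trans ht
    rw [← add_div, add_mul]
    gcongr
    exact hsub _ _ (mul_pos ha ht).le (mul_pos hb ht).le
end
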